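/- Let T be a correlation-free parity decision tree on n variables of depth d. Then E_{ℓ∈T}[(∑_{i=1}^n ℓ_i)²] ≤ d, where ℓ ranges over the leaves of T with the distribution induced by a uniform random input. -/

import Mathlib

open Finset

/-- The ±1 sign value of a boolean: `true ↦ 1`, `false ↦ -1`. -/
def bsign (b : Bool) : ℝ := if b then 1 else -1

/-- The parity character `χ_S(x) = ∏_{i ∈ S} x_i` (with `x_i = ±1`), as an integer. -/
def chi {n : ℕ} (S : Finset (Fin n)) (x : Fin n → Bool) : ℤ :=
  ∏ i ∈ S, (if x i then 1 else -1)

/-- Parity decision trees on `n` variables, with leaves labelled in `{-1,1}`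
(encoded as `Bool`, `true ↦ 1`, `false ↦ -1`).  At an internal node labelled `S`,
an input `x` follows the edge labelled `χ_S(x)`: the `tpos` child if `χ_S(x) = 1`
and the `tneg` child if `χ_S(x) = -1`. -/
inductive PDT (n : ℕ) : Type where
  | leaf (b : Bool) : PDT n
  | node (S : Finset (Fin n)) (tneg tpos : PDT n) : PDT n

namespace PDT

variable {n : ℕ}

/-- The depth of the tree: maximum number of internal nodes on a root-to-leaf path. -/
def depth : PDT n → ℕ
  | leaf _ => 0
  | node _ t0 t1 => max (depth t0) (depth t1) + 1

/-- The label of the leaf reached by input `x`. -/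
def eval : PDT n → (Fin n → Bool) → Bool
  | leaf b, _ => b
  | node S t0 t1, x => if chi S x = 1 then eval t1 x else eval t0 x

/-- The identity of the leaf reached by input `x`, recorded as the sequence of
branches taken along the root-to-leaf path. -/
def leafId : PDT n → (Fin n → Bool) → List Bool
  | leaf _, _ => []
  | node S t0 t1, x =>
      if chi S x = 1 then true :: leafId t1 x else false :: leafId t0 x

/-- Number of internal nodes on the root-to-leaf path followed by input `x`. -/
def depthOn : PDT n → (Fin n → Bool) → ℕ
  | leaf _, _ => 0
  | node S t0 t1, x =>
      (if chi S x = 1 then depthOn t1 x else depthOn t0 x) + 1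

/-- `T` computes `f` if every input reaches a leaf labelled `f x`. -/
def Computes (T : PDT n) (f : (Fin n → Bool) → Bool) : Prop :=
  ∀ x, T.eval x = f x

/-- The vector `ℓ ∈ {-1,0,1}^n` associated to the leaf reached by `x`:
`ℓ i` is the average of the `i`-th coordinate (as a `±1` value) over the
uniform distribution on inputs reaching that leaf. -/
noncomputable def leafVec (T : PDT n) (x : Fin n → Bool) (i : Fin n) : ℝ :=
  (∑ y : Fin n → Bool, if T.leafId y = T.leafId x then bsign (y i) else 0) /
    ((Finset.univ.filter fun y : Fin n → Bool => T.leafId y = T.leafId x).card)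

/-- A boolean-valued function `φ` of the input is fixed by the path to the leaf
reached by `x` if it is constant on the set of inputs reaching that leaf. -/
def FixedAt (T : PDT n) (x : Fin n → Bool) (φ : (Fin n → Bool) → Bool) : Prop :=
  ∀ y z : Fin n → Bool, T.leafId y = T.leafId x → T.leafId z = T.leafId x → φ y = φ z

/-- `T` is (pairwise) correlation-free: along any root-to-leaf path, whenever
`x_i ⊕ x_j` (for `i ≠ j`) is fixed, both `x_i` and `x_j` are fixed. -/
def CorrelationFree (T : PDT n) : Prop :=
  ∀ i j : Fin n, i ≠ j → ∀ x : Fin n → Bool,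
    FixedAt T x (fun y => xor (y i) (y j)) →
    FixedAt T x (fun y => y i) ∧ FixedAt T x (fun y => y j)

/-- `T'` refines `T`: the set of inputs reaching any given leaf of `T'` is
contained in the set of inputs reaching some leaf of `T`. -/
def Refines (T' T : PDT n) : Prop :=
  ∀ y z : Fin n → Bool, T'.leafId y = T'.leafId z → T.leafId y = T.leafId z

/-- An ordinary decision tree: every internal node queries a single coordinate. -/
def Ordinary : PDT n → Prop
  | leaf _ => True
  | node S t0 t1 => (∃ i : Fin n, S = {i}) ∧ Ordinary t0 ∧ Ordinary t1

end PDT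

/-- The linear Fourier coefficient `f̂(i) = E_x[f(x)·x_i]` over uniform `x ∈ {-1,1}^n`. -/
noncomputable def fhat {n : ℕ} (f : (Fin n → Bool) → Bool) (i : Fin n) : ℝ :=
  (∑ x : Fin n → Bool, bsign (f x) * bsign (x i)) / 2 ^ n

/-- The index of coordinate `j` of the `i`-th block of `n` consecutive coordinates. -/
def blockIdx {m n : ℕ} (i : Fin m) (j : Fin n) : Fin (m * n) :=
  ⟨i.1 * n + j.1, by
    have hj := j.isLt
    calc i.1 * n + j.1 < i.1 * n + n := by omega
      _ = (i.1 + 1) * n := by ring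
      _ ≤ m * n := Nat.mul_le_mul_right n i.isLt⟩

/-- Composition `f ∘ g` on `m·n` variables, applying `g` to each of the `m` blocks
of `n` consecutive coordinates. -/
def compose {m n : ℕ} (f : (Fin m → Bool) → Bool) (g : (Fin n → Bool) → Bool)
    (x : Fin (m * n) → Bool) : Bool :=
  f fun i => g fun j => x (blockIdx i j)

/-- `MAJ₃`: returns `1` (`true`) iff `x₁ + x₂ + x₃ > 0` for `x ∈ {-1,1}³`. -/
def maj3 (x : Fin 3 → Bool) : Bool :=
  decide (0 < (if x 0 then 1 else -1) + (if x 1 then 1 else -1) + (if x 2 then (1 : ℤ) else -1))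

/-- The recursive majority function `MAJ₃^{⊗k}`, with `MAJ₃^{⊗1} = MAJ₃` and
`MAJ₃^{⊗k}` applying `MAJ₃` to `MAJ₃^{⊗(k-1)}` evaluated on the three blocks of
`3^{k-1}` consecutive coordinates. -/
def recMaj : (k : ℕ) → (Fin (3 ^ k) → Bool) → Bool
  | 0, x => x ⟨0, by norm_num⟩
  | k + 1, x => maj3 fun b =>
      recMaj k fun j => x ⟨b.1 * 3 ^ k + j.1, by
        have hb := b.isLt
        have hj := j.isLt
        calc b.1 * 3 ^ k + j.1 < b.1 * 3 ^ k + 3 ^ k := by omega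
          _ = (b.1 + 1) * 3 ^ k := by ring
          _ ≤ 3 * 3 ^ k := Nat.mul_le_mul_right (3 ^ k) hb
          _ = 3 ^ (k + 1) := by ring⟩

/-- The coordinatewise exclusive or of three inputs. -/
def triXor {n : ℕ} (x y z : Fin n → Bool) : Fin n → Bool :=
  fun i => xor (xor (x i) (y i)) (z i)

/-- A set of inputs is affine if it is closed under the exclusive or of three elements. -/
def IsAffineSet {n : ℕ} (A : Finset (Fin n → Bool)) : Prop :=
  ∀ x ∈ A, ∀ y ∈ A, ∀ z ∈ A, triXor x y z ∈ A

/-- A `±1`-valued function which turns `triXor` into a product. -/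
structure IsSignChar {n : ℕ} (φ : (Fin n → Bool) → ℝ) : Prop where
  eq_or : ∀ x, φ x = 1 ∨ φ x = -1
  map_triXor : ∀ x y z, φ (triXor x y z) = φ x * φ y * φ z

lemma triXor_triXor {n : ℕ} (x y z : Fin n → Bool) : triXor (triXor x y z) y z = x := by
  funext i
  simp only [triXor]
  cases x i <;> cases y i <;> cases z i <;> rfl

lemma isSignChar_coord {n : ℕ} (i : Fin n) : IsSignChar fun x : Fin n → Bool => bsign (x i) where
  eq_or x := by cases h : x i <;> simp [bsign]
  map_triXor x y z := by
    simp only [triXor]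
    cases x i <;> cases y i <;> cases z i <;> simp [bsign]

lemma IsSignChar.mul {n : ℕ} {φ ψ : (Fin n → Bool) → ℝ} (hφ : IsSignChar φ)
    (hψ : IsSignChar ψ) : IsSignChar fun x => φ x * ψ x where
  eq_or x := by
    rcases hφ.eq_or x with h | h <;> rcases hψ.eq_or x with h' | h' <;> simp [h, h']
  map_triXor x y z := by rw [hφ.map_triXor, hψ.map_triXor]; ring

lemma isSignChar_chi {n : ℕ} (S : Finset (Fin n)) :
    IsSignChar fun x : Fin n → Bool => (chi S x : ℝ) := by
  induction S using Finset.induction_on with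
  | empty => exact ⟨fun x => by simp [chi], fun x y z => by simp [chi]⟩
  | insert i S hi ih =>
    have h : (fun x : Fin n → Bool => (chi (insert i S) x : ℝ)) =
        fun x => bsign (x i) * (chi S x : ℝ) := by
      funext x
      simp only [chi, Finset.prod_insert hi, bsign]
      push_cast
      rfl
    rw [h]
    exact (isSignChar_coord i).mul ih

/-- A sign character that is not constant on an affine set sums to zero over it. -/
lemma IsSignChar.sum_eq_zero {n : ℕ} {φ : (Fin n → Bool) → ℝ} (hφ : IsSignChar φ)
    {A : Finset (Fin n → Bool)} (hA : IsAffineSet A) {a b : Fin n → Bool} (ha : a ∈ A)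
    (hb : b ∈ A) (hab : φ a ≠ φ b) : ∑ x ∈ A, φ x = 0 := by
  have h1 : ∑ x ∈ A, φ x = ∑ x ∈ A, φ (triXor x a b) :=
    (Finset.sum_nbij' (fun x => triXor x a b) (fun x => triXor x a b)
      (fun x hx => hA x hx a ha b hb) (fun x hx => hA x hx a ha b hb)
      (fun x _ => triXor_triXor x a b) (fun x _ => triXor_triXor x a b) fun _ _ => rfl).symm
  have h2 : φ a * φ b = -1 := by
    rcases hφ.eq_or a with h | h <;> rcases hφ.eq_or b with h' | h' <;> simp_all
  have h3 : ∑ x ∈ A, φ (triXor x a b) = -∑ x ∈ A, φ x := by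
    rw [← Finset.sum_neg_distrib]
    refine Finset.sum_congr rfl fun x _ => ?_
    rw [hφ.map_triXor, mul_assoc, h2]
    ring
  linarith

/-- The part of an affine set on which a sign character takes one of its values is at least
half of the set. -/
lemma IsSignChar.card_le_two_mul_card_filter {n : ℕ} {φ : (Fin n → Bool) → ℝ}
    (hφ : IsSignChar φ) {A : Finset (Fin n → Bool)} (hA : IsAffineSet A)
    {a : Fin n → Bool} (ha : a ∈ A) : #A ≤ 2 * #{x ∈ A | φ x = φ a} := by
  have hle : #{x ∈ A | ¬φ x = φ a} ≤ #{x ∈ A | φ x = φ a} := by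
    by_cases h : ∃ b ∈ A, φ b ≠ φ a
    · obtain ⟨b, hb, hab⟩ := h
      refine Finset.card_le_card_of_injOn (fun x => triXor x a b) (fun x hx => ?_)
        (fun x _ y _ hxy => ?_)
      · simp only [Finset.coe_filter, Set.mem_ofPred_eq] at hx ⊢
        refine ⟨hA x hx.1 a ha b hb, ?_⟩
        rw [hφ.map_triXor]
        have hx2 := hx.2
        rcases hφ.eq_or a with h | h <;> rcases hφ.eq_or b with h' | h' <;>
          rcases hφ.eq_or x with h'' | h'' <;> simp_all
      · rw [← triXor_triXor x a b, ← triXor_triXor y a b]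
        exact congrArg (fun w => triXor w a b) hxy
    · push Not at h
      rw [Finset.filter_eq_empty_iff.2 fun x hx => not_not.2 (h x hx)]
      simp
  have := Finset.card_filter_add_card_filter_not (s := A) (fun x => φ x = φ a)
  omega

lemma IsSignChar.isAffineSet_filter {n : ℕ} {φ : (Fin n → Bool) → ℝ} (hφ : IsSignChar φ)
    {A : Finset (Fin n → Bool)} (hA : IsAffineSet A) (a : Fin n → Bool) :
    IsAffineSet {x ∈ A | φ x = φ a} := by
  intro x hx y hy z hz
  simp only [Finset.mem_filter] at hx hy hz ⊢
  refine ⟨hA x hx.1 y hy.1 z hz.1, ?_⟩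
  rw [hφ.map_triXor, hx.2, hy.2, hz.2]
  rcases hφ.eq_or a with h | h <;> simp [h]

/-- An affine set with `k` constant coordinates has at most `2 ^ (n - k)` elements. -/
lemma card_mul_two_pow_le {n : ℕ} (A : Finset (Fin n → Bool)) (K : Finset (Fin n))
    (hK : ∀ i ∈ K, ∀ x ∈ A, ∀ y ∈ A, x i = y i) : #A * 2 ^ #K ≤ 2 ^ n := by
  have h1 : #A ≤ Fintype.card ({i // i ∉ K} → Bool) := by
    refine Finset.card_le_card_of_injOn (fun x i => x i.1)
      (fun _ _ => Finset.mem_coe.2 (Finset.mem_univ _))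
      fun x hx y hy hxy => ?_
    funext i
    by_cases hi : i ∈ K
    · exact hK i hi x hx y hy
    · exact congrFun hxy ⟨i, hi⟩
  have h2 : Fintype.card {i // i ∉ K} + #K = n := by
    rw [Fintype.card_subtype_compl]
    have := K.card_le_univ
    simp at this ⊢
    omega
  calc #A * 2 ^ #K ≤ 2 ^ Fintype.card {i // i ∉ K} * 2 ^ #K := by
        refine Nat.mul_le_mul_right _ (h1.trans_eq ?_)
        simp
    _ = 2 ^ n := by rw [← pow_add, h2]

/-- Replacing every value by the average over its fibre does not change the sum. -/
lemma sum_fiber_average {α β : Type*} [Fintype α] [DecidableEq β] (g : α → β) (f : α → ℝ) :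
    ∑ x, (∑ y with g y = g x, f y) / (#{y | g y = g x} : ℝ) = ∑ x, f x := by
  simp_rw [Finset.sum_div, Finset.sum_filter]
  rw [Finset.sum_comm]
  refine Finset.sum_congr rfl fun y _ => ?_
  have h : ∀ x, (if g y = g x then f y / (#{z | g z = g x} : ℝ) else 0) =
      if g x = g y then f y / (#{z | g z = g y} : ℝ) else 0 := by
    intro x
    by_cases h : g x = g y
    · simp [h]
    · simp [h, Ne.symm h]
  simp_rw [h]
  rw [← Finset.sum_filter, Finset.sum_const, nsmul_eq_mul]
  have : (#{z | g z = g y} : ℝ) ≠ 0 :=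
    Nat.cast_ne_zero.2 (Finset.card_ne_zero.2 ⟨y, by simp⟩)
  field_simp

namespace PDT

variable {n : ℕ}

/-- The inputs reaching the same leaf as `x`. -/
def leafSet (T : PDT n) (x : Fin n → Bool) : Finset (Fin n → Bool) :=
  {y | T.leafId y = T.leafId x}

lemma mem_leafSet {T : PDT n} {x y : Fin n → Bool} :
    y ∈ T.leafSet x ↔ T.leafId y = T.leafId x := by simp [leafSet]

lemma leafId_node_eq_iff (S : Finset (Fin n)) (t0 t1 : PDT n) (x y : Fin n → Bool) :
    (node S t0 t1).leafId y = (node S t0 t1).leafId x ↔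
      (chi S y : ℝ) = chi S x ∧
        (if chi S x = 1 then t1 else t0).leafId y =
          (if chi S x = 1 then t1 else t0).leafId x := by
  have hx := (isSignChar_chi S).eq_or x
  have hy := (isSignChar_chi S).eq_or y
  norm_cast at hx hy ⊢
  rcases hx with hx | hx <;> rcases hy with hy | hy <;> simp [leafId, hx, hy]

/-- The inputs of an affine set reaching a given leaf form an affine set, which makes up at
least a `2 ^ (-depth)` fraction. -/
lemma isAffineSet_and_card_le (T : PDT n) (A : Finset (Fin n → Bool)) (hA : IsAffineSet A)
    (x : Fin n → Bool) (hx : x ∈ A) :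
    IsAffineSet {y ∈ A | T.leafId y = T.leafId x} ∧
      #A ≤ 2 ^ T.depth * #{y ∈ A | T.leafId y = T.leafId x} := by
  induction T generalizing A with
  | leaf b => simpa [leafId, depth] using hA
  | node S t0 t1 ih0 ih1 =>
    have hφ := isSignChar_chi S
    have hB := hφ.isAffineSet_filter hA x
    have hcard := hφ.card_le_two_mul_card_filter hA hx
    set B : Finset (Fin n → Bool) := {y ∈ A | (chi S y : ℝ) = chi S x} with hBdef
    have hxB : x ∈ B := by simp [hBdef, hx]
    have heq : ({y ∈ A | (node S t0 t1).leafId y = (node S t0 t1).leafId x} : Finset _) =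
        {y ∈ B | (if chi S x = 1 then t1 else t0).leafId y =
          (if chi S x = 1 then t1 else t0).leafId x} := by
      simp_rw [leafId_node_eq_iff, hBdef, Finset.filter_filter]
    rw [heq]
    have hdepth : (if chi S x = 1 then t1 else t0).depth + 1 ≤ (node S t0 t1).depth := by
      split_ifs <;> simp [depth]
    have ih : ∀ t : PDT n, t = t0 ∨ t = t1 →
        IsAffineSet {y ∈ B | t.leafId y = t.leafId x} ∧
          #B ≤ 2 ^ t.depth * #{y ∈ B | t.leafId y = t.leafId x} := by
      rintro t (rfl | rfl)
      exacts [ih0 B hB hxB, ih1 B hB hxB]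
    obtain ⟨h1, h2⟩ := ih (if chi S x = 1 then t1 else t0) (by split_ifs <;> simp)
    refine ⟨h1, ?_⟩
    generalize (if chi S x = 1 then t1 else t0) = t at h2 hdepth ⊢
    calc #A ≤ 2 * #B := hcard
      _ ≤ 2 * (2 ^ t.depth * #{y ∈ B | t.leafId y = t.leafId x}) := Nat.mul_le_mul_left _ h2
      _ = 2 ^ (t.depth + 1) * #{y ∈ B | t.leafId y = t.leafId x} := by ring
      _ ≤ _ := Nat.mul_le_mul_right _ (Nat.pow_le_pow_right two_pos hdepth)

lemma isAffineSet_leafSet (T : PDT n) (x : Fin n → Bool) : IsAffineSet (T.leafSet x) :=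
  (T.isAffineSet_and_card_le univ (fun _ _ _ _ _ _ => mem_univ _) x (mem_univ x)).1

lemma two_pow_le_card_leafSet (T : PDT n) (x : Fin n → Bool) :
    2 ^ n ≤ 2 ^ T.depth * #(T.leafSet x) := by
  simpa [leafSet] using
    (T.isAffineSet_and_card_le univ (fun _ _ _ _ _ _ => mem_univ _) x (mem_univ x)).2

/-- The number of coordinates fixed at a leaf is at most the depth of the tree. -/
lemma card_le_depth_of_fixedAt (T : PDT n) (x : Fin n → Bool) (K : Finset (Fin n))
    (hK : ∀ i ∈ K, T.FixedAt x fun y => y i) : #K ≤ T.depth := by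
  have h1 := card_mul_two_pow_le (T.leafSet x) K fun i hi y hy z hz =>
    hK i hi y z (mem_leafSet.1 hy) (mem_leafSet.1 hz)
  have h2 := T.two_pow_le_card_leafSet x
  have hpos : 0 < #(T.leafSet x) := Finset.card_pos.2 ⟨x, mem_leafSet.2 rfl⟩
  have h3 : 2 ^ #K ≤ 2 ^ T.depth := by
    refine Nat.le_of_mul_le_mul_left ?_ hpos
    calc _ ≤ _ := h1.trans h2
      _ = _ := mul_comm _ _
  exact (Nat.pow_le_pow_iff_right one_lt_two).1 h3

/-- The average over a leaf of a function that is constant on it. -/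
lemma average_eq_of_const (T : PDT n) (x : Fin n → Bool) {φ : (Fin n → Bool) → ℝ}
    (h : ∀ y ∈ T.leafSet x, φ y = φ x) :
    (∑ y ∈ T.leafSet x, φ y) / (#(T.leafSet x) : ℝ) = φ x := by
  have : (#(T.leafSet x) : ℝ) ≠ 0 :=
    Nat.cast_ne_zero.2 (Finset.card_ne_zero.2 ⟨x, mem_leafSet.2 rfl⟩)
  rw [Finset.sum_congr rfl h, Finset.sum_const, nsmul_eq_mul]
  field_simp

/-- The average of a sign character over a leaf on which it is not constant. -/
lemma average_eq_zero (T : PDT n) (x : Fin n → Bool) {φ : (Fin n → Bool) → ℝ}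
    (hφ : IsSignChar φ) (h : ¬∀ y ∈ T.leafSet x, φ y = φ x) :
    (∑ y ∈ T.leafSet x, φ y) / (#(T.leafSet x) : ℝ) = 0 := by
  push Not at h
  obtain ⟨y, hy, hyx⟩ := h
  rw [hφ.sum_eq_zero (T.isAffineSet_leafSet x) hy (mem_leafSet.2 rfl) hyx, zero_div]

lemma leafVec_eq_average (T : PDT n) (x : Fin n → Bool) (i : Fin n) :
    T.leafVec x i = (∑ y ∈ T.leafSet x, bsign (y i)) / (#(T.leafSet x) : ℝ) := by
  simp only [leafVec, leafSet, Finset.sum_filter]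

lemma fixedAt_iff_of_injective {T : PDT n} {x : Fin n → Bool} {f : (Fin n → Bool) → Bool}
    {φ : (Fin n → Bool) → ℝ} (hf : ∀ y z, f y = f z ↔ φ y = φ z) :
    T.FixedAt x f ↔ ∀ y ∈ T.leafSet x, φ y = φ x := by
  refine ⟨fun h y hy => (hf _ _).1 (h y x (mem_leafSet.1 hy) rfl), fun h y z hy hz => ?_⟩
  rw [hf, h y (mem_leafSet.2 hy), h z (mem_leafSet.2 hz)]

lemma fixedAt_coord_iff {T : PDT n} {x : Fin n → Bool} {i : Fin n} :
    T.FixedAt x (fun y => y i) ↔ ∀ y ∈ T.leafSet x, bsign (y i) = bsign (x i) :=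
  fixedAt_iff_of_injective (φ := fun y => bsign (y i)) fun y z => by
    cases y i <;> cases z i <;> norm_num [bsign]

lemma fixedAt_xor_iff {T : PDT n} {x : Fin n → Bool} {i j : Fin n} :
    T.FixedAt x (fun y => xor (y i) (y j)) ↔
      ∀ y ∈ T.leafSet x, bsign (y i) * bsign (y j) = bsign (x i) * bsign (x j) :=
  fixedAt_iff_of_injective (φ := fun y => bsign (y i) * bsign (y j)) fun y z => by
    cases y i <;> cases z i <;> cases y j <;> cases z j <;> norm_num [bsign]

lemma leafVec_of_fixedAt {T : PDT n} {x : Fin n → Bool} {i : Fin n}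
    (h : T.FixedAt x fun y => y i) : T.leafVec x i = bsign (x i) := by
  rw [leafVec_eq_average]
  exact T.average_eq_of_const x (φ := fun y => bsign (y i)) (fixedAt_coord_iff.1 h)

lemma leafVec_of_not_fixedAt {T : PDT n} {x : Fin n → Bool} {i : Fin n}
    (h : ¬T.FixedAt x fun y => y i) : T.leafVec x i = 0 := by
  rw [leafVec_eq_average]
  exact T.average_eq_zero x (isSignChar_coord i) (mt fixedAt_coord_iff.2 h)

/-- At every leaf of a correlation-free tree distinct coordinates are uncorrelated. -/
lemma CorrelationFree.leafVec_mul_leafVec {T : PDT n} (hT : T.CorrelationFree) {i j : Fin n}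
    (hij : i ≠ j) (x : Fin n → Bool) :
    T.leafVec x i * T.leafVec x j =
      (∑ y ∈ T.leafSet x, bsign (y i) * bsign (y j)) / (#(T.leafSet x) : ℝ) := by
  by_cases h : T.FixedAt x fun y => xor (y i) (y j)
  · obtain ⟨hi, hj⟩ := hT i j hij x h
    rw [leafVec_of_fixedAt hi, leafVec_of_fixedAt hj]
    exact (T.average_eq_of_const x (φ := fun y => bsign (y i) * bsign (y j))
      (fixedAt_xor_iff.1 h)).symm
  · rw [T.average_eq_zero x ((isSignChar_coord i).mul (isSignChar_coord j))
      (mt fixedAt_xor_iff.2 h)]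
    by_cases hi : T.FixedAt x fun y => y i
    · have hj : ¬T.FixedAt x fun y => y j := fun hj =>
        h fun y z hy hz => congrArg₂ xor (hi y z hy hz) (hj y z hy hz)
      rw [leafVec_of_not_fixedAt hj, mul_zero]
    · rw [leafVec_of_not_fixedAt hi, zero_mul]

lemma CorrelationFree.sum_leafVec_mul_leafVec {T : PDT n} (hT : T.CorrelationFree)
    {i j : Fin n} (hij : i ≠ j) : ∑ x, T.leafVec x i * T.leafVec x j = 0 := by
  simp_rw [hT.leafVec_mul_leafVec hij]
  refine (sum_fiber_average T.leafId fun y => bsign (y i) * bsign (y j)).trans ?_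
  refine ((isSignChar_coord i).mul (isSignChar_coord j)).sum_eq_zero
    (fun _ _ _ _ _ _ => mem_univ _) (mem_univ fun _ => true)
    (mem_univ (Function.update (fun _ => true) i false)) ?_
  norm_num [Function.update_of_ne hij.symm, bsign]

lemma sum_leafVec_sq_le_depth (T : PDT n) (x : Fin n → Bool) :
    ∑ i, T.leafVec x i ^ 2 ≤ T.depth := by
  classical
  have h : ∀ i, T.leafVec x i ^ 2 = if T.FixedAt x (fun y => y i) then 1 else 0 := by
    intro i
    split_ifs with hi
    · rw [leafVec_of_fixedAt hi]
      cases x i <;> norm_num [bsign]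
    · rw [leafVec_of_not_fixedAt hi]
      norm_num
  simp_rw [h]
  rw [Finset.sum_boole]
  exact_mod_cast T.card_le_depth_of_fixedAt x _ fun i hi => (Finset.mem_filter.1 hi).2

end PDT

/-- **Proposition.** For any correlation-free parity decision tree `T` of depth `d`,
`E_{ℓ∈T}[(∑ᵢ ℓᵢ)²] ≤ d`, where the leaf `ℓ` is distributed according to the
fraction of uniform inputs reaching it. -/
theorem correlationFree_leaf_second_moment_le {n d : ℕ} (T : PDT n)
    (hcf : T.CorrelationFree) (hd : T.depth ≤ d) :
    (∑ x : Fin n → Bool, (∑ i : Fin n, T.leafVec x i) ^ 2) / 2 ^ n ≤ d := by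
  have hsum : ∑ x : Fin n → Bool, (∑ i, T.leafVec x i) ^ 2 =
      ∑ x : Fin n → Bool, ∑ i, T.leafVec x i ^ 2 := by
    simp_rw [sq, Finset.sum_mul_sum]
    rw [Finset.sum_comm, Finset.sum_comm (s := univ (α := Fin n → Bool))]
    refine Finset.sum_congr rfl fun i _ => ?_
    rw [Finset.sum_comm]
    exact Finset.sum_eq_single i (fun j _ hj => hcf.sum_leafVec_mul_leafVec hj.symm) (by simp)
  rw [hsum, div_le_iff₀ (by positivity)]
  calc ∑ x : Fin n → Bool, ∑ i, T.leafVec x i ^ 2 ≤ ∑ _x : Fin n → Bool, (d : ℝ) :=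
        Finset.sum_le_sum fun x _ =>
          (T.sum_leafVec_sq_le_depth x).trans (Nat.cast_le.2 hd)
    _ = d * 2 ^ n := by simp [mul_comm]
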